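/- arXiv:2402.00842 — 3 statements merged into one kernel-verified Lean document; each statement's English description precedes it below -/
import Mathlib

section
/- Let R be a commutative ring, π ∈ R a non-zero-divisor, C• a bounded cochain complex of π-torsion-free flat R-modules, and S an R-module such that each C^i ⊗_R S is π-torsion-free. Assume that H^j(C•) is a flat R-module for every j. Then for every i, the natural map H^i(C• ⊗̂_R S) → H^i(C•) ⊗̂_R S is an isomorphism, where ⊗̂ denotes the π-adically completed tensor product. -/
open TensorProduct

/-- The cohomology of a cochain complex `(C, d)` at the spot `j + 1`:
`ker (d (j+1)) / im (d j)`. -/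
abbrev CohomologyAt {R : Type*} [CommRing R] {C : ℤ → Type*} [∀ i, AddCommGroup (C i)]
    [∀ i, Module R (C i)] (d : ∀ i, C i →ₗ[R] C (i + 1)) (j : ℤ) : Type _ :=
  ↥(LinearMap.ker (d (j + 1))) ⧸
    Submodule.comap (LinearMap.ker (d (j + 1))).subtype (LinearMap.range (d j))

namespace St3

section general
variable {R : Type*} [CommRing R]
variable {M : Type*} [AddCommGroup M] [Module R M]
variable {N : Type*} [AddCommGroup N] [Module R N]
variable {P : Type*} [AddCommGroup P] [Module R P]

/-- The `I`-adic filtration on `M` is induced from `N` along `f`. -/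
def Strict (I : Ideal R) (f : M →ₗ[R] N) : Prop :=
  ∀ (n : ℕ) (m : M), f m ∈ (I ^ n • ⊤ : Submodule R N) → m ∈ (I ^ n • ⊤ : Submodule R M)

lemma Strict.comp {I : Ideal R} {f : M →ₗ[R] N} {g : N →ₗ[R] P} (hg : Strict I g)
    (hf : Strict I f) : Strict I (g ∘ₗ f) := fun n m h => hf n m (hg n _ h)

lemma Strict.map_injective {I : Ideal R} {f : M →ₗ[R] N} (hf : Strict I f) :
    Function.Injective (AdicCompletion.map I f) := by
  rw [injective_iff_map_eq_zero]
  intro x hx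
  ext n
  have h := congrArg (fun y => y.val n) hx
  simp only [AdicCompletion.map_val_apply] at h
  obtain ⟨m, hm⟩ := Submodule.Quotient.mk_surjective _ (x.val n)
  rw [← hm] at h ⊢
  have h2 : f m ∈ (I ^ n • ⊤ : Submodule R N) := by
    rw [← Submodule.Quotient.mk_eq_zero]
    exact h
  have := hf n m h2
  rw [← Submodule.Quotient.mk_eq_zero] at this
  exact this

lemma Strict.map_exact {I : Ideal R} {f : M →ₗ[R] N} {g : N →ₗ[R] P} (hf : Strict I f)
    (hfg : Function.Exact f g) (hg : Function.Surjective g) :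
    Function.Exact (AdicCompletion.map I f) (AdicCompletion.map I g) := by
  intro x
  constructor
  · intro hx
    obtain ⟨a, rfl⟩ := AdicCompletion.mk_surjective I N x
    have key : ∀ n, ∃ m : M, a n - f m ∈ (I ^ n • ⊤ : Submodule R N) := by
      intro n
      have h : Submodule.Quotient.mk (p := (I ^ n • ⊤ : Submodule R P)) (g (a n)) = 0 :=
        congrArg (fun y => y.val n) hx
      rw [Submodule.Quotient.mk_eq_zero] at h
      have h2 : g (a n) ∈ Submodule.map g (I ^ n • ⊤ : Submodule R N) := by
        rwa [Submodule.map_smul'', Submodule.map_top, LinearMap.range_eq_top.2 hg]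
      obtain ⟨u, hu, hgu⟩ := h2
      obtain ⟨m, hm⟩ := (hfg (a n - u)).1 (by rw [map_sub, hgu, sub_self])
      refine ⟨m, ?_⟩
      rw [hm]
      simpa using hu
    choose m hm using key
    have hc : ∀ n, m n ≡ m (n + 1) [SMOD (I ^ n • ⊤ : Submodule R M)] := by
      intro n
      rw [SModEq.sub_mem]
      apply hf
      have h1 := hm n
      have h2 : a (n + 1) - f (m (n + 1)) ∈ (I ^ n • ⊤ : Submodule R N) :=
        Submodule.smul_mono_left (Ideal.pow_le_pow_right n.le_succ) (hm (n + 1))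
      have h3 : a n - a (n + 1) ∈ (I ^ n • ⊤ : Submodule R N) := by
        rw [← SModEq.sub_mem]
        exact AdicCompletion.AdicCauchySequence.mk_eq_mk n.le_succ a |>.symm
      have h4 := Submodule.add_mem _ (Submodule.sub_mem _ h2 h1) h3
      convert h4 using 1
      rw [map_sub]; abel
    refine ⟨AdicCompletion.mk I M (AdicCompletion.AdicCauchySequence.mk I M m hc), ?_⟩
    rw [AdicCompletion.map_mk, ← sub_eq_zero, ← map_sub]
    ext n
    have : f (m n) - a n ∈ (I ^ n • ⊤ : Submodule R N) := by
      rw [← neg_sub]; exact Submodule.neg_mem _ (hm n)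
    rw [← Submodule.Quotient.mk_eq_zero] at this
    exact this
  · rintro ⟨y, rfl⟩
    rw [AdicCompletion.map_comp_apply, hfg.linearMap_comp_eq_zero, AdicCompletion.map_zero]
    rfl

lemma rTensor_inj [Module.Flat R P] {f : M →ₗ[R] N} {g : N →ₗ[R] P}
    (hf : Function.Injective f) (hfg : Function.Exact f g) (hg : Function.Surjective g)
    (A : Type*) [AddCommGroup A] [Module R A] : Function.Injective (f.rTensor A) := by
  rw [← LinearMap.lTensor_inj_iff_rTensor_inj]
  exact LinearMap.lTensor_injective_of_exact_of_flat g hg f hf hfg A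

lemma strict_rTensor [Module.Flat R P] (I : Ideal R) {f : M →ₗ[R] N} {g : N →ₗ[R] P}
    (hf : Function.Injective f) (hfg : Function.Exact f g) (hg : Function.Surjective g)
    (S : Type*) [AddCommGroup S] [Module R S] : Strict I (f.rTensor S) := by
  intro n m hm
  let J : Submodule R S := I ^ n • ⊤
  have hz : ∀ z ∈ (I ^ n • ⊤ : Submodule R (N ⊗[R] S)), (J.mkQ.lTensor N) z = 0 := by
    intro z hz
    refine Submodule.smul_induction_on hz ?_ ?_
    · intro r hr x _
      induction x with
      | zero => simp
      | add x y hx hy => rw [smul_add, map_add, hx trivial, hy trivial, add_zero]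
      | tmul x s =>
        rw [← TensorProduct.tmul_smul, LinearMap.lTensor_tmul]
        have : J.mkQ (r • s) = 0 := by
          rw [Submodule.mkQ_apply, Submodule.Quotient.mk_eq_zero]
          exact Submodule.smul_mem_smul hr trivial
        rw [this, TensorProduct.tmul_zero]
    · intro x y hx hy
      rw [map_add, hx, hy, add_zero]
  have h1 := hz _ hm
  have h2 : (f.rTensor (S ⧸ J)) ((J.mkQ.lTensor M) m) = 0 := by
    rw [← h1, ← LinearMap.comp_apply, ← LinearMap.comp_apply, LinearMap.rTensor_comp_lTensor,
      LinearMap.lTensor_comp_rTensor]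
  have h3 : (J.mkQ.lTensor M) m = 0 :=
    rTensor_inj hf hfg hg (S ⧸ J) (by rw [h2, map_zero])
  have hex : Function.Exact (J.subtype.lTensor M) (J.mkQ.lTensor M) :=
    lTensor_exact M (LinearMap.exact_subtype_mkQ J) J.mkQ_surjective
  obtain ⟨y, rfl⟩ := (hex m).1 h3
  clear h1 h2 h3 hm
  induction y with
  | zero => simp
  | add x y hx hy => rw [map_add]; exact Submodule.add_mem _ hx hy
  | tmul x s =>
    rw [LinearMap.lTensor_tmul]
    obtain ⟨s, hs⟩ := s
    change x ⊗ₜ s ∈ _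
    refine Submodule.smul_induction_on hs ?_ ?_
    · intro r hr t _
      rw [TensorProduct.tmul_smul]
      exact Submodule.smul_mem_smul hr trivial
    · intro s t hs ht
      rw [TensorProduct.tmul_add]
      exact Submodule.add_mem _ hs ht

lemma flat_ker [Module.Flat R N] [Module.Flat R P] {f : M →ₗ[R] N} {g : N →ₗ[R] P}
    (hf : Function.Injective f) (hfg : Function.Exact f g) (hg : Function.Surjective g) :
    Module.Flat R M := by
  rw [Module.Flat.iff_lTensor_preserves_injective_linearMap]
  intro A B _ _ _ _ h hh
  have h1 : Function.Injective (f.rTensor A) := rTensor_inj hf hfg hg A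
  have h2 : Function.Injective (h.lTensor N) :=
    Module.Flat.lTensor_preserves_injective_linearMap h hh
  have h3 : Function.Injective ((f.rTensor B) ∘ₗ (h.lTensor M)) := by
    rw [LinearMap.rTensor_comp_lTensor, ← LinearMap.lTensor_comp_rTensor]
    exact h2.comp h1
  exact Function.Injective.of_comp h3

end general

section cplx
variable {R : Type*} [CommRing R] {C : ℤ → Type*} [∀ i, AddCommGroup (C i)]
    [∀ i, Module R (C i)] (d : ∀ i, C i →ₗ[R] C (i + 1))

/-- The inclusion of boundaries in cycles. -/
def bz (hdd : ∀ i, (d (i + 1)).comp (d i) = 0) (i : ℤ) :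
    LinearMap.range (d i) →ₗ[R] LinearMap.ker (d (i + 1)) :=
  Submodule.inclusion (by rw [LinearMap.range_le_ker_iff]; exact hdd i)

/-- The projection from cycles to cohomology. -/
def zh (i : ℤ) : LinearMap.ker (d (i + 1)) →ₗ[R] CohomologyAt d i := Submodule.mkQ _

lemma bz_inj (hdd : ∀ i, (d (i + 1)).comp (d i) = 0) (i : ℤ) :
    Function.Injective (bz d hdd i) := Submodule.inclusion_injective _

lemma zh_surj (i : ℤ) : Function.Surjective (zh d i) := Submodule.mkQ_surjective _

lemma bz_zh_exact (hdd : ∀ i, (d (i + 1)).comp (d i) = 0) (i : ℤ) :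
    Function.Exact (bz d hdd i) (zh d i) := by
  intro x
  rw [zh, Submodule.mkQ_apply, Submodule.Quotient.mk_eq_zero]
  constructor
  · intro h
    exact ⟨⟨x.1, h⟩, rfl⟩
  · rintro ⟨y, rfl⟩
    exact y.2

lemma zc_exact (i : ℤ) :
    Function.Exact (LinearMap.ker (d i)).subtype (d i).rangeRestrict := by
  rw [LinearMap.exact_iff, LinearMap.ker_rangeRestrict, Submodule.range_subtype]

lemma flat_all (hdd : ∀ i, (d (i + 1)).comp (d i) = 0)
    (hbounded : ∃ N : ℕ, ∀ i : ℤ, ((i : ℤ) < -(N : ℤ) ∨ (N : ℤ) < i) → Subsingleton (C i))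
    (hflatC : ∀ i, Module.Flat R (C i))
    (hflatH : ∀ j : ℤ, Module.Flat R (CohomologyAt d j)) (i : ℤ) :
    Module.Flat R (LinearMap.range (d i)) ∧ Module.Flat R (LinearMap.ker (d i)) := by
  obtain ⟨N, hN⟩ := hbounded
  have step : ∀ i, Module.Flat R (LinearMap.ker (d (i + 1))) →
      Module.Flat R (LinearMap.range (d i)) ∧ Module.Flat R (LinearMap.ker (d i)) := by
    intro i h
    have hH := hflatH i
    have hC := hflatC i
    have hB : Module.Flat R (LinearMap.range (d i)) :=
      flat_ker (bz_inj d hdd i) (bz_zh_exact d hdd i) (zh_surj d i)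
    exact ⟨hB, flat_ker (Submodule.subtype_injective _) (zc_exact d i)
      (LinearMap.surjective_rangeRestrict _)⟩
  have hbig : ∀ i : ℤ, (N : ℤ) < i → Module.Flat R (LinearMap.ker (d i)) := by
    intro i hi
    have := hN i (Or.inr hi)
    infer_instance
  have hdown : ∀ k : ℕ, ∀ i : ℤ, (N : ℤ) < i + k → Module.Flat R (LinearMap.ker (d i)) := by
    intro k
    induction k with
    | zero => intro i hi; exact hbig i (by simpa using hi)
    | succ k ih => intro i hi; exact (step i (ih (i + 1) (by push_cast at hi; lia))).2
  refine step i (hdown ((N : ℤ) - i).toNat _ ?_)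
  lia

end cplx

end St3

open St3 in
theorem statement3 (R : Type*) [CommRing R] (π : R) (hπ : π ∈ nonZeroDivisors R)
    (C : ℤ → Type*) [∀ i, AddCommGroup (C i)] [∀ i, Module R (C i)]
    (d : ∀ i, C i →ₗ[R] C (i + 1))
    (hdd : ∀ i, (d (i + 1)).comp (d i) = 0)
    (hbounded : ∃ N : ℕ, ∀ i : ℤ, ((i : ℤ) < -(N : ℤ) ∨ (N : ℤ) < i) → Subsingleton (C i))
    (htf : ∀ i, ∀ x : C i, π • x = 0 → x = 0)
    (hflatC : ∀ i, Module.Flat R (C i))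
    (hflatH : ∀ j : ℤ, Module.Flat R (CohomologyAt d j))
    (S : Type*) [AddCommGroup S] [Module R S]
    (htfS : ∀ i, ∀ x : C i ⊗[R] S, π • x = 0 → x = 0) :
    ∀ j : ℤ,
      Nonempty
        (CohomologyAt
            (fun i =>
              (AdicCompletion.map (Ideal.span {π})
                (LinearMap.rTensor S (d i))).restrictScalars R) j
          ≃ₗ[R] AdicCompletion (Ideal.span {π}) (CohomologyAt d j ⊗[R] S)) := by
  intro j
  have hfl := flat_all d hdd hbounded hflatC hflatH
  have hB := fun i => (hfl i).1
  generalize Ideal.span {π} = I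
  have sz : ∀ i, Strict I ((LinearMap.ker (d i)).subtype.rTensor S) := fun i =>
    strict_rTensor I (Submodule.subtype_injective _) (zc_exact d i)
      (LinearMap.surjective_rangeRestrict _) S
  have sb : ∀ i, Strict I ((bz d hdd i).rTensor S) := fun i =>
    strict_rTensor I (bz_inj d hdd i) (bz_zh_exact d hdd i) (zh_surj d i) S
  have ez : ∀ i, Function.Exact (AdicCompletion.map I ((LinearMap.ker (d i)).subtype.rTensor S))
      (AdicCompletion.map I ((d i).rangeRestrict.rTensor S)) := fun i =>
    (sz i).map_exact (rTensor_exact S (zc_exact d i) (LinearMap.surjective_rangeRestrict _))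
      (LinearMap.rTensor_surjective S (LinearMap.surjective_rangeRestrict _))
  have eb : ∀ i, Function.Exact (AdicCompletion.map I ((bz d hdd i).rTensor S))
      (AdicCompletion.map I ((zh d i).rTensor S)) := fun i =>
    (sb i).map_exact (rTensor_exact S (bz_zh_exact d hdd i) (zh_surj d i))
      (LinearMap.rTensor_surjective S (zh_surj d i))
  have sp : ∀ i, Function.Surjective (AdicCompletion.map I ((d i).rangeRestrict.rTensor S)) :=
    fun i => AdicCompletion.map_surjective I
      (LinearMap.rTensor_surjective S (LinearMap.surjective_rangeRestrict _))
  have sh : Function.Surjective (AdicCompletion.map I ((zh d j).rTensor S)) :=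
    AdicCompletion.map_surjective I (LinearMap.rTensor_surjective S (zh_surj d j))
  have iz : ∀ i, Function.Injective
      (AdicCompletion.map I ((LinearMap.ker (d i)).subtype.rTensor S)) := fun i =>
    (sz i).map_injective
  have ib : ∀ i, Function.Injective (AdicCompletion.map I ((bz d hdd i).rTensor S)) := fun i =>
    (sb i).map_injective
  -- factorisation of the differential
  have hd : ∀ i x, AdicCompletion.map I ((d i).rTensor S) x =
      AdicCompletion.map I ((LinearMap.ker (d (i + 1))).subtype.rTensor S)
        (AdicCompletion.map I ((bz d hdd i).rTensor S)
          (AdicCompletion.map I ((d i).rangeRestrict.rTensor S) x)) := by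
    intro i x
    rw [AdicCompletion.map_comp_apply, AdicCompletion.map_comp_apply, ← LinearMap.rTensor_comp,
      ← LinearMap.rTensor_comp]
    rfl
  have hker : ∀ i x, AdicCompletion.map I ((d i).rTensor S) x = 0 ↔
      x ∈ Set.range (AdicCompletion.map I ((LinearMap.ker (d i)).subtype.rTensor S)) := by
    intro i x
    rw [hd, ← ez i x]
    constructor
    · intro h
      exact ib i (iz (i + 1) (by rw [h, map_zero, map_zero]))
    · intro h
      rw [h, map_zero, map_zero]
  set D := (fun i : ℤ => (AdicCompletion.map I (LinearMap.rTensor S (d i))).restrictScalars R)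
    with hD
  let φ0 : AdicCompletion I (LinearMap.ker (d (j + 1)) ⊗[R] S) →ₗ[R] LinearMap.ker (D (j + 1)) :=
    LinearMap.codRestrict _
      ((AdicCompletion.map I ((LinearMap.ker (d (j + 1))).subtype.rTensor S)).restrictScalars R)
      (fun x => (hker (j + 1) _).2 ⟨x, rfl⟩)
  let φ : AdicCompletion I (LinearMap.ker (d (j + 1)) ⊗[R] S) →ₗ[R] CohomologyAt D j :=
    (zh D j) ∘ₗ φ0
  let ψ : AdicCompletion I (LinearMap.ker (d (j + 1)) ⊗[R] S) →ₗ[R]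
      AdicCompletion I (CohomologyAt d j ⊗[R] S) :=
    (AdicCompletion.map I ((zh d j).rTensor S)).restrictScalars R
  have hφ : Function.Surjective φ := by
    refine (zh_surj D j).comp ?_
    rintro ⟨x, hx⟩
    obtain ⟨y, hy⟩ := (hker (j + 1) x).1 hx
    exact ⟨y, Subtype.ext hy⟩
  have hψ : Function.Surjective ψ := sh
  have hk : LinearMap.ker φ = LinearMap.ker ψ := by
    ext x
    have h1 : x ∈ LinearMap.ker ψ ↔ _ := eb j x
    rw [h1]
    have h2 : x ∈ LinearMap.ker φ ↔ ∃ y, D j y =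
        AdicCompletion.map I ((LinearMap.ker (d (j + 1))).subtype.rTensor S) x := by
      rw [LinearMap.mem_ker]
      change zh D j (φ0 x) = 0 ↔ _
      rw [zh, Submodule.mkQ_apply, Submodule.Quotient.mk_eq_zero]
      rfl
    rw [h2]
    constructor
    · rintro ⟨y, hy⟩
      refine ⟨_, iz (j + 1) ((hd j y).symm.trans hy)⟩
    · rintro ⟨y, rfl⟩
      obtain ⟨y, rfl⟩ := sp j y
      exact ⟨y, hd j y⟩
  exact ⟨(φ.quotKerEquivOfSurjective hφ).symm ≪≫ₗ Submodule.quotEquivOfEq _ _ hk ≪≫ₗ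
    ψ.quotKerEquivOfSurjective hψ⟩
end

section
/- Let A be a Noetherian commutative ring and let C• be a bounded cochain complex of flat A-modules such that each H^i(C•) is a finitely generated A-module. Then there exists a bounded complex P• of finitely generated projective A-modules together with a quasi-isomorphism P• → C•. -/
open CategoryTheory
namespace Mumford
open Limits ZeroObject
universe w
theorem flat_of_exact {A : Type} [CommRing A] {M N P : Type w} [AddCommGroup M] [AddCommGroup N]
    [AddCommGroup P] [Module A M] [Module A N] [Module A P] [Module.Flat A N] [Module.Flat A P]
    (f : M →ₗ[A] N) (g : N →ₗ[A] P) (hf : Function.Injective f) (hg : Function.Surjective g)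
    (hfg : Function.Exact f g) : Module.Flat A M := by
  rw [Module.Flat.iff_rTensor_preserves_injective_linearMap]
  intro Q R _ _ _ _ u hu
  have h1 : Function.Injective (f.lTensor Q) :=
    LinearMap.lTensor_injective_of_exact_of_flat g hg f hf hfg Q
  have h2 := Module.Flat.rTensor_preserves_injective_linearMap (M := N) u hu
  have h3 : f.lTensor R ∘ₗ u.rTensor M = u.rTensor N ∘ₗ f.lTensor Q := by
    rw [LinearMap.lTensor_comp_rTensor, LinearMap.rTensor_comp_lTensor]
  have h4 : Function.Injective (f.lTensor R ∘ₗ u.rTensor M) := by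
    rw [h3]
    exact h2.comp h1
  exact Function.Injective.of_comp h4

theorem flat_prod {A : Type} [CommRing A] (M N : Type w) [AddCommGroup M] [AddCommGroup N]
    [Module A M] [Module A N] (hM : Module.Flat A M) (hN : Module.Flat A N) :
    Module.Flat A (M × N) := by
  rw [Module.Flat.iff_rTensor_preserves_injective_linearMap]
  intro Q R _ _ _ _ u hu
  have key : ∀ {L : Type w} [AddCommGroup L] [Module A L] (_ : Module.Flat A L)
      (p : (M × N) →ₗ[A] L) (x : TensorProduct A Q (M × N)),
      u.rTensor (M × N) x = 0 → p.lTensor Q x = 0 := by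
    intro L _ _ _ p x hx
    apply Module.Flat.rTensor_preserves_injective_linearMap (M := L) u hu
    have h3 : p.lTensor R ∘ₗ u.rTensor (M × N) = u.rTensor L ∘ₗ p.lTensor Q := by
      rw [LinearMap.lTensor_comp_rTensor, LinearMap.rTensor_comp_lTensor]
    have := LinearMap.congr_fun h3 x
    simp only [LinearMap.comp_apply, hx, map_zero] at this
    rw [← this, map_zero]
  rw [injective_iff_map_eq_zero]
  intro x hx
  have e : LinearMap.inl A M N ∘ₗ LinearMap.fst A M N + LinearMap.inr A M N ∘ₗ LinearMap.snd A M N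
      = LinearMap.id := by ext <;> simp
  have e2 := LinearMap.congr_fun (congrArg (LinearMap.lTensor Q) e) x
  rw [LinearMap.lTensor_add, LinearMap.lTensor_comp, LinearMap.lTensor_comp, LinearMap.lTensor_id,
    LinearMap.add_apply, LinearMap.comp_apply, LinearMap.comp_apply, key hM _ x hx, key hN _ x hx] at e2
  simpa using e2.symm

theorem finite_of_exact {A : Type} [CommRing A] [IsNoetherianRing A]
    (S : ShortComplex (ModuleCat.{w} A)) (hS : S.Exact) (h1 : Module.Finite A S.X₁)
    (h3 : Module.Finite A S.X₃) : Module.Finite A S.X₂ := by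
  have := isNoetherian_of_isNoetherianRing_of_finite A S.X₁
  have := isNoetherian_of_isNoetherianRing_of_finite A S.X₃
  have := isNoetherian_of_range_eq_ker S.f.hom S.g.hom hS.moduleCat_range_eq_ker
  infer_instance

theorem finite_of_iso {A : Type} [CommRing A] {M N : ModuleCat.{w} A} (e : M ≅ N)
    (h : Module.Finite A M) : Module.Finite A N := Module.Finite.equiv e.toLinearEquiv

theorem finite_homology {A : Type} [CommRing A] [IsNoetherianRing A]
    (P : CochainComplex (ModuleCat.{w} A) ℤ) (i : ℤ) (h : Module.Finite A (P.X i)) :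
    Module.Finite A (P.homology i) := by
  have := isNoetherian_of_isNoetherianRing_of_finite A (P.X i)
  have h1 : Function.Injective (P.iCycles i).hom :=
    (ModuleCat.mono_iff_injective _).1 inferInstance
  have h2 : Function.Surjective (P.homologyπ i).hom :=
    (ModuleCat.epi_iff_surjective _).1 inferInstance
  have := Module.Finite.of_injective _ h1
  exact Module.Finite.of_surjective _ h2

theorem exists_surj {A : Type} [CommRing A] 
    (K : CochainComplex (ModuleCat.{w} A) ℤ) (j : ℤ) (h : Module.Finite A (K.homology j)) :
    ∃ (F : ModuleCat.{w} A) (s : (HomologicalComplex.single _ (ComplexShape.up ℤ) j).obj F ⟶ K),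
      Module.Finite A F ∧ Module.Projective A F ∧ Epi (HomologicalComplex.homologyMap s j) := by
  obtain ⟨n, f, hf⟩ := Module.Finite.exists_fin' A (K.homology j)
  let F : ModuleCat.{w} A := ModuleCat.of A (ULift.{w} (Fin n → A))
  have : Module.Projective A F := Module.Projective.of_equiv (ULift.moduleEquiv (R := A) (M := Fin n → A)).symm
  let g : F ⟶ K.homology j := ModuleCat.ofHom (f ∘ₗ ULift.moduleEquiv.toLinearMap)
  have hg : Epi g := (ModuleCat.epi_iff_surjective _).2 (by
    intro x
    obtain ⟨y, rfl⟩ := hf x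
    exact ⟨ULift.up y, rfl⟩)
  have h2 : Function.Surjective (K.homologyπ j).hom :=
    (ModuleCat.epi_iff_surjective _).1 inferInstance
  obtain ⟨l, hl⟩ := Module.projective_lifting_property (K.homologyπ j).hom g.hom h2
  let l' : F ⟶ K.cycles j := ModuleCat.ofHom l
  have hl' : l' ≫ K.homologyπ j = g := by ext1; exact hl
  refine ⟨F, HomologicalComplex.mkHomFromSingle (l' ≫ K.iCycles j) (by simp), ?_, this, ?_⟩
  · exact Module.Finite.equiv (ULift.moduleEquiv (R := A) (M := Fin n → A)).symm
  · set s := HomologicalComplex.mkHomFromSingle (l' ≫ K.iCycles j) (by simp)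
    have h3 : (HomologicalComplex.singleObjCyclesSelfIso (ComplexShape.up ℤ) j F).inv ≫ HomologicalComplex.cyclesMap s j = l' := by
      rw [← cancel_mono (K.iCycles j)]
      simp [s]
    have h4 : (HomologicalComplex.singleObjCyclesSelfIso (ComplexShape.up ℤ) j F).inv ≫ 
       HomologicalComplex.homologyπ _ j ≫ HomologicalComplex.homologyMap s j = g := by
      rw [HomologicalComplex.homologyπ_naturality, reassoc_of% h3, hl']
    rw [← Category.assoc] at h4
    exact epi_of_epi_fac h4
def Good {A : Type} [CommRing A] (P : CochainComplex (ModuleCat.{w} A) ℤ) : Prop :=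
  (∀ i, Module.Finite A (P.X i) ∧ Module.Projective A (P.X i)) ∧
      (∃ N : ℕ, ∀ i : ℤ, (i < -(N : ℤ) ∨ (N : ℤ) < i) → Subsingleton (P.X i))

noncomputable def coneXEquiv {A : Type} [CommRing A] {S W : CochainComplex (ModuleCat.{w} A) ℤ}
    (f : S ⟶ W) (i : ℤ) : ((CochainComplex.mappingCone f).X i) ≃ₗ[A] (S.X (i+1) × W.X i) := 
  ((HomologicalComplex.homotopyCofiber.XIsoBiprod f i (i+1) rfl) ≪≫ 
    ModuleCat.biprodIsoProd _ _).toLinearEquiv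

theorem good_cone {A : Type} [CommRing A] {S W : CochainComplex (ModuleCat.{w} A) ℤ}
    (f : S ⟶ W) (hS : Good S) (hW : Good W) : Good (CochainComplex.mappingCone f) := by
  obtain ⟨hS, N, hN⟩ := hS
  obtain ⟨hW, M, hM⟩ := hW
  refine ⟨fun i => ?_, N + M + 1, fun i hi => ?_⟩
  · have := (hS (i+1)).1
    have := (hS (i+1)).2
    have := (hW i).1
    have := (hW i).2
    exact ⟨Module.Finite.equiv (coneXEquiv f i).symm, Module.Projective.of_equiv (coneXEquiv f i).symm⟩
  · have := hN (i+1) (by push_cast at hi; omega)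
    have := hM i (by push_cast at hi; omega)
    exact (coneXEquiv f i).toEquiv.subsingleton

theorem good_single {A : Type} [CommRing A] (F : ModuleCat.{w} A) (j : ℤ)
    (h1 : Module.Finite A F) (h2 : Module.Projective A F) : 
    Good ((HomologicalComplex.single _ (ComplexShape.up ℤ) j).obj F) := by
  have hz : ∀ i ≠ j, Subsingleton (((HomologicalComplex.single _ (ComplexShape.up ℤ) j).obj F).X i) :=
    fun i hi => ModuleCat.isZero_iff_subsingleton.1 (HomologicalComplex.isZero_single_obj_X _ _ _ _ hi)
  refine ⟨fun i => ?_, j.natAbs, fun i hi => hz i (by omega)⟩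
  by_cases h : i = j
  · subst h
    let e := (HomologicalComplex.singleObjXSelf (ComplexShape.up ℤ) i F).toLinearEquiv.symm
    exact ⟨Module.Finite.equiv e, Module.Projective.of_equiv e⟩
  · have := hz i h
    exact ⟨inferInstance, inferInstance⟩

theorem good_zero {A : Type} [CommRing A] : Good (0 : CochainComplex (ModuleCat.{w} A) ℤ) := by
  have hz : ∀ i, Subsingleton ((0 : CochainComplex (ModuleCat.{w} A) ℤ).X i) := fun i => 
    ModuleCat.isZero_iff_subsingleton.1 
      ((HomologicalComplex.eval _ _ i).map_isZero (Limits.isZero_zero _))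
  exact ⟨fun i => ⟨inferInstance, inferInstance⟩, 0, fun i _ => hz i⟩

open Pretriangulated

noncomputable abbrev QQ (A : Type) [CommRing A] : CochainComplex (ModuleCat.{w} A) ℤ ⥤ HomotopyCategory (ModuleCat.{w} A) (ComplexShape.up ℤ) :=
  HomotopyCategory.quotient (ModuleCat.{w} A) (ComplexShape.up ℤ)

noncomputable abbrev HH (A : Type) [CommRing A] (i : ℤ) : HomotopyCategory (ModuleCat.{w} A) (ComplexShape.up ℤ) ⥤ ModuleCat.{w} A :=
  (HomotopyCategory.homologyFunctor (ModuleCat.{w} A) (ComplexShape.up ℤ) 0).shift i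

noncomputable def HHfac (A : Type) [CommRing A] (i : ℤ) : 
    QQ.{w} A ⋙ HH A i ≅ HomologicalComplex.homologyFunctor _ _ i :=
  HomotopyCategory.homologyFunctorFactors (ModuleCat.{w} A) (ComplexShape.up ℤ) i

def St {A : Type} [CommRing A] (X : HomotopyCategory (ModuleCat.{w} A) (ComplexShape.up ℤ)) (n : ℤ) : Prop :=
  ∃ (K W : CochainComplex (ModuleCat.{w} A) ℤ) (g : K ⟶ W) (b : (QQ A).obj W ⟶ X)
    (c : X ⟶ ((QQ A).obj K)⟦(1:ℤ)⟧), Good W ∧ (Triangle.mk ((QQ A).map g) b c ∈ distTriang _) ∧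
    (∀ i, Module.Finite A ((HH A i).obj ((QQ A).obj K))) ∧ ∀ i, n ≤ i → Limits.IsZero ((HH A i).obj ((QQ A).obj K))

theorem st_base {A : Type} [CommRing A] [IsNoetherianRing A] 
    (X : HomotopyCategory (ModuleCat.{w} A) (ComplexShape.up ℤ))
    (n : ℤ) (hX : ∀ i, Module.Finite A ((HH A i).obj X)) (hX' : ∀ i, n ≤ i → Limits.IsZero ((HH A i).obj X)) :
    St X (n+1) := by
  obtain ⟨K, g, c, h⟩ := distinguished_cocone_triangle₁ (0 : (QQ A).obj 0 ⟶ X)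
  obtain ⟨K, rfl⟩ := HomotopyCategory.quotient_obj_surjective K
  obtain ⟨g, rfl⟩ := (QQ A).map_surjective g
  have hz : ∀ i, Limits.IsZero ((HH A i).obj ((QQ A).obj 0)) := fun i => 
    (QQ A ⋙ HH A i).map_isZero (Limits.isZero_zero _)
  refine ⟨K, 0, g, 0, c, good_zero, h, fun i => ?_, fun i hi => ?_⟩
  · have := Functor.homologySequence_exact₁ (HomotopyCategory.homologyFunctor (ModuleCat.{w} A) (ComplexShape.up ℤ) 0) _ h (i-1) i (by omega)
    refine finite_of_exact _ this (hX _) ?_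
    have := ModuleCat.isZero_iff_subsingleton.1 (hz i)
    change Module.Finite A ((HH A i).obj ((QQ A).obj 0))
    infer_instance
  · have := Functor.homologySequence_exact₁ (HomotopyCategory.homologyFunctor (ModuleCat.{w} A) (ComplexShape.up ℤ) 0) _ h (i-1) i (by omega)
    exact this.isZero_of_both_zeros ((hX' _ (by omega)).eq_of_src _ _) ((hz i).eq_of_tgt _ _)

theorem st_step {A : Type} [CommRing A] [IsNoetherianRing A] 
    (X : HomotopyCategory (ModuleCat.{w} A) (ComplexShape.up ℤ))
    (n : ℤ) (hX : St X (n+1)) : St X n := by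
  obtain ⟨K, W, g, b, c, hW, h, h1, h2⟩ := hX
  obtain ⟨F, s, hF, hF', hs⟩ := exists_surj K n (finite_of_iso ((HHfac A n).app K) (h1 n))
  let S := (HomologicalComplex.single _ (ComplexShape.up ℤ) n).obj F
  have t1 := HomotopyCategory.mappingCone_triangleh_distinguished s
  have t2 := HomotopyCategory.mappingCone_triangleh_distinguished (s ≫ g)
  let o := Triangulated.someOctahedron ((QQ A).map_comp s g).symm t1 h t2
  have hm := o.mem
  obtain ⟨m, hm'⟩ := (QQ A).map_surjective o.m₁
  rw [← hm'] at hm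
  have gS := good_single F n hF hF'
  have hSf : ∀ i, Module.Finite A ((HH A i).obj ((QQ A).obj S)) := fun i =>
    finite_of_iso ((HHfac A i).app S).symm (finite_homology S i (gS.1 i).1)
  have hSz : ∀ i, i ≠ n → Limits.IsZero ((HH A i).obj ((QQ A).obj S)) := fun i hi =>
    (HomologicalComplex.isZero_single_obj_homology _ _ _ _ hi).of_iso ((HHfac A i).app S)
  have hse : Epi ((HH A n).map ((QQ A).map s)) := by
    have e := (HHfac A n).hom.naturality s
    have : Epi ((HomologicalComplex.homologyFunctor _ _ n).map s) := hs
    have h3 : (HH A n).map ((QQ A).map s) = (HHfac A n).hom.app _ ≫ (HomologicalComplex.homologyFunctor _ _ n).map s ≫ (HHfac A n).inv.app _ := by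
      rw [← reassoc_of% e]; simp
    rw [h3]
    infer_instance
  refine ⟨_, _, m, _, _, good_cone (s ≫ g) gS hW, hm, fun i => ?_, fun i hi => ?_⟩
  · have := Functor.homologySequence_exact₃ (HomotopyCategory.homologyFunctor (ModuleCat.{w} A) (ComplexShape.up ℤ) 0) _ t1 i (i+1) rfl
    exact finite_of_exact _ this (h1 _) (hSf _)
  · have := Functor.homologySequence_exact₃ (HomotopyCategory.homologyFunctor (ModuleCat.{w} A) (ComplexShape.up ℤ) 0) _ t1 i (i+1) rfl
    refine this.isZero_of_both_zeros ?_ ((hSz _ (by omega)).eq_of_tgt _ _)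
    by_cases hin : i = n
    · subst hin
      exact (Functor.homologySequence_epi_shift_map_mor₁_iff (HomotopyCategory.homologyFunctor (ModuleCat.{w} A) (ComplexShape.up ℤ) 0) _ t1 i).1 hse
    · exact (h2 i (by omega)).eq_of_src _ _

theorem st_all {A : Type} [CommRing A] [IsNoetherianRing A] 
    (X : HomotopyCategory (ModuleCat.{w} A) (ComplexShape.up ℤ))
    (n : ℤ) (hX : St X n) (m : ℕ) : St X (n - m) := by
  induction m with
  | zero => simpa using hX
  | succ m ih => 
    apply st_step
    convert ih using 1
    push_cast; ring

theorem flat_opcycles {A : Type} [CommRing A] (L : CochainComplex (ModuleCat.{w} A) ℤ)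
    (hL : ∀ i, Module.Flat A (L.X i)) (N n : ℤ) (hN : ∀ i, N < i → Subsingleton (L.X i))
    (hn : ∀ i, n ≤ i → L.ExactAt i) (i : ℤ) (hi : n ≤ i) : Module.Flat A (L.opcycles i) := by
  suffices H : ∀ (m : ℕ) (i : ℤ), N - m < i → n ≤ i → Module.Flat A (L.opcycles i) from
    H (N - i + 1).toNat i (by omega) hi
  intro m
  induction m with
  | zero => 
    intro i h1 h2
    have := hN i (by simpa using h1)
    have h2 : Function.Surjective (L.pOpcycles i).hom :=
      (ModuleCat.epi_iff_surjective _).1 inferInstance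
    have := h2.subsingleton
    infer_instance
  | succ m ih => 
    intro i h1 h2
    have := ih (i+1) (by push_cast at h1; omega) (by omega)
    have := hL (i+1)
    have hm : Mono (L.fromOpcycles i (i+1)) := by
      have hz := (hn i h2).isZero_homology
      exact (ShortComplex.exact_of_f_is_kernel (ShortComplex.mk _ _ (L.homologyι_comp_fromOpcycles i (i+1)))
        (L.homologyIsKernel i (i+1) (by simp))).mono_g (hz.eq_of_src _ _)
    let S := ShortComplex.mk (L.d i (i+1)) (L.pOpcycles (i+1)) (by simp)
    have hS : S.Exact := S.exact_of_g_is_cokernel (L.opcyclesIsCokernel i (i+1) (by simp))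
    have h4 : Function.Exact (L.d i (i+1)).hom (L.pOpcycles (i+1)).hom := 
      (ShortComplex.ShortExact.moduleCat_exact_iff_function_exact S).1 hS
    refine flat_of_exact (L.fromOpcycles i (i+1)).hom (L.pOpcycles (i+1)).hom
      ((ModuleCat.mono_iff_injective _).1 hm) ((ModuleCat.epi_iff_surjective _).1 inferInstance) ?_
    have h2 : Function.Surjective (L.pOpcycles i).hom :=
      (ModuleCat.epi_iff_surjective _).1 inferInstance
    have h5 : ∀ x, (L.fromOpcycles i (i+1)).hom ((L.pOpcycles i).hom x) = (L.d i (i+1)).hom x := by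
      intro x
      rw [← L.p_fromOpcycles i (i+1)]; rfl
    intro y
    rw [h4 y]
    constructor
    · rintro ⟨x, rfl⟩
      exact ⟨_, h5 x⟩
    · rintro ⟨x, rfl⟩
      obtain ⟨x, rfl⟩ := h2 x
      exact ⟨x, (h5 x).symm⟩

theorem flat_transfer {A : Type} [CommRing A] {P C : CochainComplex (ModuleCat.{w} A) ℤ}
    (h : P ⟶ C) (i j : ℤ) (hij : i + 1 = j) (hC : IsZero (C.X i))
    (hf : Module.Flat A ((CochainComplex.mappingCone h).opcycles i)) : Module.Flat A (P.opcycles j) := by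
  let α : P.opcycles j ⟶ (CochainComplex.mappingCone h).opcycles i :=
    P.descOpcycles ((CochainComplex.mappingCone.inl h).v j i (by omega) ≫ HomologicalComplex.pOpcycles _ i)
      i (by simp; omega) (by
        have e := CochainComplex.mappingCone.inl_v_d h i (i-1) j (by omega) (by omega)
        have e1 : h.f i = 0 := hC.eq_of_tgt _ _
        rw [e1, zero_comp, zero_sub] at e
        have e2 : P.d i j ≫ (CochainComplex.mappingCone.inl h).v j i (by omega) = 
          -((CochainComplex.mappingCone.inl h).v i (i-1) (by omega) ≫ (CochainComplex.mappingCone h).d (i-1) i) := by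
          rw [e, neg_neg]
        rw [reassoc_of% e2]
        simp)
  let β : (CochainComplex.mappingCone h).opcycles i ⟶ P.opcycles j :=
    HomologicalComplex.descOpcycles _ ((CochainComplex.mappingCone.fst h).1.v i j hij ≫ P.pOpcycles j)
      (i-1) (by simp) (by
        rw [← Category.assoc, CochainComplex.mappingCone.d_fst_v h (i-1) i j (by omega) hij]
        simp)
  have hαβ : α ≫ β = 𝟙 _ := by
    rw [← cancel_epi (P.pOpcycles j)]
    simp [α, β]
  refine Module.Flat.of_retract α.hom β.hom ?_
  rw [← ModuleCat.hom_comp, hαβ]; rfl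

theorem main (A : Type) [CommRing A] [IsNoetherianRing A]
    (C : CochainComplex (ModuleCat.{w} A) ℤ)
    (hflat : ∀ i, Module.Flat A (C.X i))
    (hbounded : ∃ N : ℕ, ∀ i : ℤ, (i < -(N : ℤ) ∨ (N : ℤ) < i) → Subsingleton (C.X i))
    (hfg : ∀ i, Module.Finite A (C.homology i)) :
    ∃ (P : CochainComplex (ModuleCat.{w} A) ℤ) (h : P ⟶ C),
      (∀ i, Module.Finite A (P.X i) ∧ Module.Projective A (P.X i)) ∧
      (∃ N : ℕ, ∀ i : ℤ, (i < -(N : ℤ) ∨ (N : ℤ) < i) → Subsingleton (P.X i)) ∧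
      QuasiIso h := by
  obtain ⟨N, hN⟩ := hbounded
  have hz : ∀ i : ℤ, (i < -(N : ℤ) ∨ (N : ℤ) < i) → IsZero (C.X i) := fun i hi =>
    ModuleCat.isZero_iff_subsingleton.2 (hN i hi)
  have hb := st_base ((QQ A).obj C) (N+1) (fun i => finite_of_iso ((HHfac A i).app C).symm (hfg i))
    (fun i hi => by
      refine IsZero.of_iso ?_ ((HHfac A i).app C)
      exact (ShortComplex.exact_iff_isZero_homology _).1
        (ShortComplex.exact_of_isZero_X₂ (C.sc i) (hz i (by omega))))
  have hs := st_all _ _ hb (2 * N + 4)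
  have hnum : (N : ℤ) + 1 + 1 - ((2 * N + 4 : ℕ) : ℤ) = -N - 2 := by push_cast; ring
  rw [hnum] at hs
  obtain ⟨K, W, g, b, c, hW, ht, -, hK⟩ := hs
  obtain ⟨h, rfl⟩ := (QQ A).map_surjective b
  have hiso : ∀ i : ℤ, -N - 2 ≤ i → IsIso ((HH A i).map ((QQ A).map h)) := by
    intro i hi
    have h1 := (Functor.homologySequence_mono_shift_map_mor₂_iff (HomotopyCategory.homologyFunctor (ModuleCat.{w} A) (ComplexShape.up ℤ) 0) _ ht i).2 ((hK i hi).eq_of_src _ _)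
    have h2 := (Functor.homologySequence_epi_shift_map_mor₂_iff (HomotopyCategory.homologyFunctor (ModuleCat.{w} A) (ComplexShape.up ℤ) 0) _ ht i (i+1) rfl).2 ((hK (i+1) (by omega)).eq_of_tgt _ _)
    change Mono ((HH A i).map ((QQ A).map h)) at h1
    change Epi ((HH A i).map ((QQ A).map h)) at h2
    exact isIso_of_mono_of_epi _
  have hq : ∀ i : ℤ, -N - 2 ≤ i → QuasiIsoAt h i := by
    intro i hi
    rw [quasiIsoAt_iff_isIso_homologyMap]
    have := hiso i hi
    exact (NatIso.isIso_map_iff (HHfac A i) h).1 this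
  have hcone : ∀ i : ℤ, -N - 2 ≤ i → (CochainComplex.mappingCone h).ExactAt i := by
    intro i hi
    rw [HomologicalComplex.exactAt_iff_isZero_homology]
    have t := HomotopyCategory.mappingCone_triangleh_distinguished h
    have ex := Functor.homologySequence_exact₃ (HomotopyCategory.homologyFunctor (ModuleCat.{w} A) (ComplexShape.up ℤ) 0) _ t i (i+1) rfl
    have i1 := hiso i hi
    have i2 := hiso (i+1) (by omega)
    have e1 := (Functor.homologySequence_epi_shift_map_mor₁_iff (HomotopyCategory.homologyFunctor (ModuleCat.{w} A) (ComplexShape.up ℤ) 0) _ t i).1 (inferInstanceAs (Epi ((HH A i).map ((QQ A).map h))))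
    have e2 := (Functor.homologySequence_mono_shift_map_mor₁_iff (HomotopyCategory.homologyFunctor (ModuleCat.{w} A) (ComplexShape.up ℤ) 0) _ t i (i+1) rfl).1 (inferInstanceAs (Mono ((HH A (i+1)).map ((QQ A).map h))))
    have := ex.isZero_of_both_zeros e1 e2
    exact this.of_iso ((HHfac A i).app (CochainComplex.mappingCone h)).symm
  obtain ⟨hW, M, hM⟩ := hW
  have hfl : Module.Flat A ((CochainComplex.mappingCone h).opcycles (-N - 2)) := by
    refine flat_opcycles _ (fun i => ?_) (N + M + 1) (-N-2) (fun i hi => ?_) hcone _ le_rfl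
    · have := (hW (i+1)).2
      have := hflat i
      have := flat_prod (A := A) (W.X (i+1)) (C.X i) inferInstance inferInstance
      exact Module.Flat.of_linearEquiv (coneXEquiv h i)
    · have := hM (i+1) (by omega)
      have := hN i (by omega)
      exact (coneXEquiv h i).toEquiv.subsingleton
  have hfl2 := flat_transfer h (-N-2) (-N-1) (by ring) (hz _ (by omega)) hfl
  have : C.IsStrictlyGE (-N-1) := (C.isStrictlyGE_iff _).2 (fun i hi => hz i (by omega))
  refine ⟨W.truncGE (-N-1), CochainComplex.truncGEMap h (-N-1) ≫ inv (C.πTruncGE (-N-1)), fun i => ?_, 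
    ⟨N + M + 1, fun i hi => ?_⟩, ?_⟩
  · rcases lt_trichotomy i (-N-1) with hi | hi | hi
    · have := ModuleCat.isZero_iff_subsingleton.1 ((W.truncGE (-N-1)).isZero_of_isStrictlyGE (-N-1) i hi)
      exact ⟨inferInstance, inferInstance⟩
    · subst hi
      let e := (W.truncGEXIsoOpcycles (-N-1)).toLinearEquiv.symm
      have := (hW (-N-1)).1
      have f1 : Module.Finite A (W.opcycles (-N-1)) := 
        Module.Finite.of_surjective (W.pOpcycles (-N-1)).hom ((ModuleCat.epi_iff_surjective _).1 inferInstance)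
      have f2 : Module.FinitePresentation A (W.opcycles (-N-1)) := Module.finitePresentation_of_finite A _
      have f3 : Module.Projective A (W.opcycles (-N-1)) := Module.Flat.projective_of_finitePresentation
      exact ⟨Module.Finite.equiv e, Module.Projective.of_equiv e⟩
    · let e := (W.truncGEXIso (-N-1) i hi).toLinearEquiv.symm
      have := (hW i).1
      have := (hW i).2
      exact ⟨Module.Finite.equiv e, Module.Projective.of_equiv e⟩
  · push_cast at hi
    by_cases hi' : i < -N-1
    · exact ModuleCat.isZero_iff_subsingleton.1 ((W.truncGE (-N-1)).isZero_of_isStrictlyGE (-N-1) i hi')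
    · have := hM i (by omega)
      exact (W.truncGEXIso (-N-1) i (by omega)).toLinearEquiv.toEquiv.subsingleton
  · have : QuasiIso (CochainComplex.truncGEMap h (-N-1)) := by
      rw [CochainComplex.quasiIso_truncGEMap_iff]
      exact fun i hi => hq i (by omega)
    infer_instance

end Mumford


/-- Mumford's lemma.  Over a Noetherian commutative ring `A`, any
bounded cochain complex of flat `A`-modules with finitely generated cohomology modules
admits a quasi-isomorphism from a bounded complex of finitely generated projective
`A`-modules. -/
theorem statement5 (A : Type) [CommRing A] [IsNoetherianRing A]
    (C : CochainComplex (ModuleCat A) ℤ)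
    (hflat : ∀ i, Module.Flat A (C.X i))
    (hbounded : ∃ N : ℕ, ∀ i : ℤ, (i < -(N : ℤ) ∨ (N : ℤ) < i) → Subsingleton (C.X i))
    (hfg : ∀ i, Module.Finite A (C.homology i)) :
    ∃ (P : CochainComplex (ModuleCat A) ℤ) (h : P ⟶ C),
      (∀ i, Module.Finite A (P.X i) ∧ Module.Projective A (P.X i)) ∧
      (∃ N : ℕ, ∀ i : ℤ, (i < -(N : ℤ) ∨ (N : ℤ) < i) → Subsingleton (P.X i)) ∧
      QuasiIso h := by
  exact Mumford.main A C hflat hbounded hfg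
end

section
/- Let A be a reduced commutative Jacobson ring and M a finitely generated A-module. If there exists r ∈ ℕ such that for every maximal ideal 𝔪 of A, dim_{A/𝔪} (M ⊗_A A/𝔪) = r (more generally dim over an algebraic closure of the residue field), then M is a projective A-module of constant rank r; locally M is free of rank r. -/
open TensorProduct

/-- In a fibre over a maximal ideal not containing `f`, relations have coefficients in `n`. -/
lemma aux_coeff_mem (A : Type) [CommRing A]
    (M : Type) [AddCommGroup M] [Module A M]
    (r : ℕ) (n : Ideal A) [hn : n.IsMaximal]
    (hfib : Module.finrank (A ⧸ n) ((A ⧸ n) ⊗[A] M) = r)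
    (x : Fin r → M) (f : A) (hf : f ∉ n)
    (hx : ∀ y : M, ∃ v : Fin r → A, ∑ i, v i • x i = f • y)
    (v : Fin r → A) (hv : ∑ i, v i • x i = 0) (i : Fin r) : v i ∈ n := by
  letI : Field (A ⧸ n) := Ideal.Quotient.field n
  have key : ∀ (a : A) (y : M), Ideal.Quotient.mk n a • ((1 : A ⧸ n) ⊗ₜ[A] y) =
      (1 : A ⧸ n) ⊗ₜ[A] (a • y) := by
    intro a y
    rw [TensorProduct.tmul_smul]
    exact algebraMap_smul (A ⧸ n) a _
  have key2 : ∀ v : Fin r → A, ∑ i, Ideal.Quotient.mk n (v i) • ((1 : A ⧸ n) ⊗ₜ[A] x i) =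
      (1 : A ⧸ n) ⊗ₜ[A] (∑ i, v i • x i) := by
    intro v
    rw [TensorProduct.tmul_sum]
    exact Finset.sum_congr rfl fun i _ => key _ _
  have hf0 : Ideal.Quotient.mk n f ≠ 0 := by
    rwa [Ne, Ideal.Quotient.eq_zero_iff_mem]
  have hspan : ⊤ ≤ Submodule.span (A ⧸ n)
      (Set.range fun i => (1 : A ⧸ n) ⊗ₜ[A] x i) := by
    rintro z -
    induction z with
    | zero => exact Submodule.zero_mem _
    | add a b ha hb => exact Submodule.add_mem _ ha hb
    | tmul c y =>
      have h1 : c ⊗ₜ[A] y = (c * (Ideal.Quotient.mk n f)⁻¹) •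
          (Ideal.Quotient.mk n f • ((1 : A ⧸ n) ⊗ₜ[A] y)) := by
        rw [smul_smul, mul_assoc, inv_mul_cancel₀ hf0, mul_one, TensorProduct.smul_tmul',
          smul_eq_mul, mul_one]
      rw [h1, key]
      obtain ⟨w, hw⟩ := hx y
      rw [← hw, ← key2]
      exact Submodule.smul_mem _ _ (Submodule.sum_mem _ fun i _ =>
        Submodule.smul_mem _ _ (Submodule.subset_span ⟨i, rfl⟩))
  have hli := linearIndependent_of_top_le_span_of_card_eq_finrank hspan (by simp [hfib])
  have := Fintype.linearIndependent_iff.mp hli (fun i => Ideal.Quotient.mk n (v i))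
    (by rw [key2, hv, TensorProduct.tmul_zero]) i
  rwa [Ideal.Quotient.eq_zero_iff_mem] at this

/-- Local generators with annihilated kernel and cokernel. -/
lemma aux_local (A : Type) [CommRing A] [IsReduced A] [IsJacobsonRing A]
    (M : Type) [AddCommGroup M] [Module A M] [Module.Finite A M]
    (r : ℕ)
    (hfib : ∀ (𝔪 : Ideal A), 𝔪.IsMaximal →
      Module.finrank (A ⧸ 𝔪) ((A ⧸ 𝔪) ⊗[A] M) = r)
    (m : Ideal A) (hm : m.IsMaximal) :
    ∃ f : A, f ∉ m ∧ ∃ φ : (Fin r → A) →ₗ[A] M,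
      (∀ y, ∃ v, φ v = f • y) ∧ ∀ v, φ v = 0 → f • v = 0 := by
  letI : Field (A ⧸ m) := Ideal.Quotient.field m
  have hsurj : ∀ z : (A ⧸ m) ⊗[A] M, ∃ y : M, (1 : A ⧸ m) ⊗ₜ[A] y = z :=
    TensorProduct.mk_surjective A M (A ⧸ m) Ideal.Quotient.mk_surjective
  let b := Module.finBasisOfFinrankEq (A ⧸ m) ((A ⧸ m) ⊗[A] M) (hfib m hm)
  choose x hx using fun i => hsurj (b i)
  have hle : (⊤ : Submodule A M) ≤ Submodule.span A (Set.range x) ⊔ m • ⊤ := by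
    rintro y -
    choose a ha using fun i => Ideal.Quotient.mk_surjective (I := m)
      (b.repr ((1 : A ⧸ m) ⊗ₜ[A] y) i)
    have h1 : (1 : A ⧸ m) ⊗ₜ[A] y = (1 : A ⧸ m) ⊗ₜ[A] (∑ i, a i • x i) := by
      conv_lhs => rw [← b.sum_repr ((1 : A ⧸ m) ⊗ₜ[A] y)]
      rw [TensorProduct.tmul_sum]
      refine Finset.sum_congr rfl fun i _ => ?_
      rw [← ha, ← hx, TensorProduct.tmul_smul]
      exact algebraMap_smul (A ⧸ m) (a i) _
    have h2 := congrArg (TensorProduct.quotTensorEquivQuotSMul M m) h1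
    rw [← map_one (Ideal.Quotient.mk m), TensorProduct.quotTensorEquivQuotSMul_mk_tmul,
      TensorProduct.quotTensorEquivQuotSMul_mk_tmul, one_smul, one_smul,
      Submodule.Quotient.eq] at h2
    rw [← add_sub_cancel (∑ i, a i • x i) y]
    exact Submodule.add_mem_sup (Submodule.sum_mem _ fun i _ =>
        Submodule.smul_mem _ _ (Submodule.subset_span ⟨i, rfl⟩)) h2
  obtain ⟨f, hf1, hf2⟩ := Submodule.exists_sub_one_mem_and_smul_le_of_fg_of_le_sup
    Module.Finite.fg_top le_rfl hle
  have hgen : ∀ y : M, ∃ v : Fin r → A, ∑ i, v i • x i = f • y := fun y =>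
    (Submodule.mem_span_range_iff_exists_fun A).mp
      (hf2 (Submodule.smul_mem_pointwise_smul y f ⊤ trivial))
  refine ⟨f, fun h => ?_, Fintype.linearCombination A x, ?_, ?_⟩
  · exact hm.ne_top ((Ideal.eq_top_iff_one m).mpr (by simpa using m.sub_mem h hf1))
  · simpa [Fintype.linearCombination_apply] using hgen
  · intro v hv
    ext i
    have hmem : f * v i ∈ (⊥ : Ideal A).jacobson := by
      rw [Ideal.jacobson, Submodule.mem_sInf]
      rintro n ⟨-, hn⟩
      by_cases hfn : f ∈ n
      · exact Ideal.mul_mem_right _ n hfn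
      · exact Ideal.mul_mem_left n _ (aux_coeff_mem A M r n (hfib n hn) x f hfn hgen v
          (by simpa [Fintype.linearCombination_apply] using hv) i)
    rw [← Ideal.radical_eq_jacobson] at hmem
    obtain ⟨k, hk⟩ := hmem
    exact eq_zero_of_pow_eq_zero (n := k) (by simpa using hk)

/-- After localizing so that `f` becomes invertible, `φ` becomes an isomorphism. -/
lemma aux_equiv (A : Type) [CommRing A]
    (M : Type) [AddCommGroup M] [Module A M]
    (r : ℕ) (f : A) (φ : (Fin r → A) →ₗ[A] M)
    (h1 : ∀ y, ∃ v, φ v = f • y) (h2 : ∀ v, φ v = 0 → f • v = 0)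
    (S : Submonoid A) (hfS : f ∈ S) :
    Nonempty (LocalizedModule S (Fin r → A) ≃ₗ[Localization S] LocalizedModule S M) := by
  refine ⟨LinearEquiv.ofBijective (LocalizedModule.map S φ) ⟨?_, ?_⟩⟩
  · rw [injective_iff_map_eq_zero]
    intro z hz
    induction z using LocalizedModule.induction_on with
    | h v s =>
      rw [LocalizedModule.map_mk, ← LocalizedModule.zero_mk 1, LocalizedModule.mk_eq] at hz
      obtain ⟨u, hu⟩ := hz
      rw [← LocalizedModule.zero_mk 1, LocalizedModule.mk_eq]
      refine ⟨⟨f, hfS⟩ * u, ?_⟩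
      have := h2 ((u : A) • v) (by simpa [Submonoid.smul_def] using hu)
      simpa [Submonoid.smul_def, mul_smul] using this
  · intro z
    induction z using LocalizedModule.induction_on with
    | h y s =>
      obtain ⟨v, hv⟩ := h1 y
      refine ⟨LocalizedModule.mk v (⟨f, hfS⟩ * s), ?_⟩
      rw [LocalizedModule.map_mk, hv]
      exact LocalizedModule.mk_cancel_common_left ⟨f, hfS⟩ s y

/-- Let `A` be a reduced commutative Jacobson ring and `M` a
finitely generated `A`-module.  If the fiber dimension `dim_{A/𝔪} (M ⊗_A A/𝔪)` equals
`r` at every maximal ideal `𝔪`, then `M` is projective of constant rank `r`: locally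
(at every prime) `M` is free of rank `r`. -/
theorem statement19 (A : Type) [CommRing A] [IsReduced A] [IsJacobsonRing A]
    (M : Type) [AddCommGroup M] [Module A M] [Module.Finite A M]
    (r : ℕ)
    (hfib : ∀ (𝔪 : Ideal A), 𝔪.IsMaximal →
      Module.finrank (A ⧸ 𝔪) ((A ⧸ 𝔪) ⊗[A] M) = r) :
    Module.Projective A M ∧
    ∀ (p : Ideal A) [p.IsPrime],
      Module.Free (Localization.AtPrime p) (LocalizedModule p.primeCompl M) ∧
      Module.finrank (Localization.AtPrime p) (LocalizedModule p.primeCompl M) = r := by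
  have hloc := aux_local A M r hfib
  have hfree : ∀ S : Submonoid A,
      Module.Free (Localization S) (LocalizedModule S (Fin r → A)) := fun S =>
    Module.free_of_isLocalizedModule S (LocalizedModule.mkLinearMap S (Fin r → A))
  have hp : ∀ (p : Ideal A) [p.IsPrime],
      Module.Free (Localization.AtPrime p) (LocalizedModule p.primeCompl M) ∧
      Module.finrank (Localization.AtPrime p) (LocalizedModule p.primeCompl M) = r := by
    intro p hp
    obtain ⟨m, hm, hpm⟩ := p.exists_le_maximal hp.ne_top
    obtain ⟨f, hfm, φ, h1, h2⟩ := hloc m hm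
    obtain ⟨e⟩ := aux_equiv A M r f φ h1 h2 p.primeCompl (fun h => hfm (hpm h))
    have := hfree p.primeCompl
    refine ⟨Module.Free.of_equiv e, ?_⟩
    rw [← e.finrank_eq, Module.finrank_of_isLocalizedModule_of_free (Localization.AtPrime p)
      p.primeCompl (LocalizedModule.mkLinearMap p.primeCompl (Fin r → A))]
    have : Nontrivial A := ⟨0, 1, fun h => hp.ne_top ((Ideal.eq_top_iff_one p).mpr (h ▸ p.zero_mem))⟩
    simp
  refine ⟨?_, hp⟩
  have hfp : Module.FinitePresentation A M := by
    obtain ⟨n, ψ, hψ⟩ := Module.Finite.exists_fin' A M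
    refine Module.finitePresentation_of_surjective ψ hψ ?_
    let s : Set A := {f | ∃ φ : (Fin r → A) →ₗ[A] M,
      (∀ y, ∃ v, φ v = f • y) ∧ ∀ v, φ v = 0 → f • v = 0}
    have hs : Ideal.span s = ⊤ := by
      by_contra hne
      obtain ⟨m, hm, hle⟩ := (Ideal.span s).exists_le_maximal hne
      obtain ⟨f, hfm, h⟩ := hloc m hm
      exact hfm (hle (Ideal.subset_span h))
    refine Submodule.of_localizationSpan s hs ?_
    rintro ⟨f, φ, h1, h2⟩
    obtain ⟨e⟩ := aux_equiv A M r f φ h1 h2 (Submonoid.powers f) (Submonoid.mem_powers f)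
    have hfin : Module.FinitePresentation (Localization (Submonoid.powers f))
      (LocalizedModule (Submonoid.powers f) M) := .of_equiv e
    have := Module.FinitePresentation.fg_ker (LocalizedModule.map (Submonoid.powers f) ψ)
      (LocalizedModule.map_surjective _ ψ hψ)
    have h3 := LinearMap.localized'_ker_eq_ker_localizedMap (Localization (Submonoid.powers f))
      (Submonoid.powers f) (LocalizedModule.mkLinearMap (Submonoid.powers f) _)
      (LocalizedModule.mkLinearMap (Submonoid.powers f) _) ψ
    change (Submodule.localized' _ _ _ _).FG
    rw [h3]
    exact this
  exact Module.projective_of_localization_maximal fun I hI =>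
    have := (hp I).1
    inferInstance
end
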